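/- For all real numbers r > 0, s > 0, every nonnegative integer n, and every real number x, if c is a complex number with c² = -rs(r+s), then (1/√(πs)) ∫_{-∞}^{∞} exp(-(x-ξ)²/s) · exp(-ξ²/r) · (2ξ)^n dξ = √(r/(r+s)) · exp(-x²/(r+s)) · (c/(r+s))^n · H_n(r x / c), where H_n is evaluated as a polynomial at the complex argument r x / c. -/

import Mathlib

open Finset MeasureTheory

/-- The physicists' Hermite polynomials, extended to complex arguments. -/
noncomputable def HphysC (n : ℕ) (x : ℂ) : ℂ :=
  ∑ l ∈ Finset.range (n / 2 + 1),
    (-1 : ℂ) ^ l * (Nat.factorial n : ℂ) /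
      ((Nat.factorial l : ℂ) * (Nat.factorial (n - 2 * l) : ℂ)) * (2 * x) ^ (n - 2 * l)

theorem HphysC_eq_sum_of_le {n N : ℕ} (hN : n / 2 + 1 ≤ N) (y : ℂ) :
    HphysC n y = ∑ l ∈ Finset.range N, if 2 * l ≤ n then
      (-1 : ℂ) ^ l * (Nat.factorial n : ℂ) /
        ((Nat.factorial l : ℂ) * (Nat.factorial (n - 2 * l) : ℂ)) * (2 * y) ^ (n - 2 * l)
      else 0 := by
  rw [HphysC, ← Finset.sum_subset (Finset.range_mono hN)]
  · refine Finset.sum_congr rfl fun l hl => ?_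
    rw [Finset.mem_range] at hl
    rw [if_pos (by omega)]
  · intro l _ hl
    rw [Finset.mem_range] at hl
    rw [if_neg (by omega)]

/-- The three-term recurrence of the Hermite polynomials. -/
theorem HphysC_add_two (n : ℕ) (y : ℂ) :
    HphysC (n + 2) y = 2 * y * HphysC (n + 1) y - 2 * (n + 1) * HphysC n y := by
  rw [HphysC_eq_sum_of_le (N := n / 2 + 1 + 1) (by omega) y,
    HphysC_eq_sum_of_le (n := n + 1) (N := n / 2 + 1 + 1) (by omega) y,
    HphysC_eq_sum_of_le (n := n) le_rfl y, Finset.sum_range_succ' _ (n / 2 + 1),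
    Finset.sum_range_succ' _ (n / 2 + 1), mul_add, Finset.mul_sum, Finset.mul_sum, add_sub_right_comm, ← Finset.sum_sub_distrib]
  congr 1
  · refine Finset.sum_congr rfl fun l hl => ?_
    rw [Finset.mem_range] at hl
    obtain ⟨d, rfl⟩ : ∃ d, n = 2 * l + d := ⟨n - 2 * l, by omega⟩
    have hl0 : (Nat.factorial l : ℂ) ≠ 0 := by exact_mod_cast l.factorial_ne_zero
    have hl1 : (l : ℂ) + 1 ≠ 0 := by exact_mod_cast l.succ_ne_zero
    rw [if_pos (by omega : 2 * (l + 1) ≤ 2 * l + d + 2), if_pos (by omega : 2 * l ≤ 2 * l + d),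
      show 2 * l + d + 2 - 2 * (l + 1) = d by omega,
      show 2 * l + d - 2 * l = d by omega]
    rcases d with _ | d
    · rw [if_neg (by omega)]
      simp only [Nat.factorial_succ, Nat.add_zero]
      push_cast
      field_simp
      ring
    · have hd0 : (Nat.factorial d : ℂ) ≠ 0 := by exact_mod_cast d.factorial_ne_zero
      have hd1 : (d : ℂ) + 1 ≠ 0 := by exact_mod_cast d.succ_ne_zero
      rw [if_pos (by omega), show 2 * l + (d + 1) + 1 - 2 * (l + 1) = d by omega,
        show 2 * l + (d + 1) + 2 = 2 * l + d + 1 + 1 + 1 by ring,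
        show 2 * l + (d + 1) + 1 = 2 * l + d + 1 + 1 by ring, ← Nat.add_assoc (2 * l) d 1]
      simp only [Nat.factorial_succ]
      push_cast
      field_simp
      ring
  · have h1 : (Nat.factorial (n + 1) : ℂ) ≠ 0 := by exact_mod_cast (n + 1).factorial_ne_zero
    have h2 : (Nat.factorial (n + 2) : ℂ) ≠ 0 := by exact_mod_cast (n + 2).factorial_ne_zero
    simp [h1, h2]
    ring

theorem integrable_eval_mul_exp_neg_mul_sq {b : ℝ} (hb : 0 < b) (p : Polynomial ℝ) :
    Integrable fun t : ℝ => p.eval t * Real.exp (-b * t ^ 2) := by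
  induction p using Polynomial.induction_on' with
  | add p q hp hq =>
    simp only [Polynomial.eval_add, add_mul]
    exact hp.add hq
  | monomial k a =>
    have h := integrable_rpow_mul_exp_neg_mul_sq hb (s := k)
      (by linarith [k.cast_nonneg (α := ℝ)])
    simp only [Real.rpow_natCast] at h
    simpa only [Polynomial.eval_monomial, mul_assoc] using h.const_mul a

theorem integrable_pow_mul_exp_neg_mul_sub_sq {b : ℝ} (hb : 0 < b) (m : ℝ) (n : ℕ) :
    Integrable fun t : ℝ => (2 * t) ^ n * Real.exp (-b * (t - m) ^ 2) := by
  have h := (integrable_eval_mul_exp_neg_mul_sq hb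
    ((2 * (Polynomial.X + Polynomial.C m)) ^ n)).comp_sub_right m
  simpa using h

/-- The recurrence satisfied by the moments of a Gaussian, from integration by parts. -/
theorem integral_pow_add_two_mul_exp_neg_mul_sub_sq {b : ℝ} (hb : 0 < b) (m : ℝ) (n : ℕ) :
    ∫ t : ℝ, (2 * t) ^ (n + 2) * Real.exp (-b * (t - m) ^ 2) =
      2 * m * (∫ t : ℝ, (2 * t) ^ (n + 1) * Real.exp (-b * (t - m) ^ 2)) +
        2 * (n + 1) / b * ∫ t : ℝ, (2 * t) ^ n * Real.exp (-b * (t - m) ^ 2) := by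
  have hi := integrable_pow_mul_exp_neg_mul_sub_sq hb m
  have hd (t : ℝ) : HasDerivAt (fun t : ℝ => (2 * t) ^ (n + 1) * Real.exp (-b * (t - m) ^ 2))
      (2 * (n + 1) * ((2 * t) ^ n * Real.exp (-b * (t - m) ^ 2)) +
        2 * b * m * ((2 * t) ^ (n + 1) * Real.exp (-b * (t - m) ^ 2)) -
        b * ((2 * t) ^ (n + 2) * Real.exp (-b * (t - m) ^ 2))) t := by
    have h1 : HasDerivAt (fun t : ℝ => (2 * t) ^ (n + 1)) _ t :=
      ((hasDerivAt_id t).const_mul 2).pow (n + 1)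
    have h2 : HasDerivAt (fun t : ℝ => Real.exp (-b * (t - m) ^ 2)) _ t :=
      ((((hasDerivAt_id t).sub_const m).pow 2).const_mul (-b)).exp
    refine (h1.mul h2).congr_deriv ?_
    simp
    ring
  have hi' := ((hi n).const_mul (2 * (n + 1 : ℝ))).fun_add ((hi (n + 1)).const_mul (2 * b * m))
  have h := integral_eq_zero_of_hasDerivAt_of_integrable hd
    (hi'.sub ((hi (n + 2)).const_mul b)) (hi (n + 1))
  rw [integral_sub hi' ((hi (n + 2)).const_mul b),
    integral_add ((hi n).const_mul _) ((hi (n + 1)).const_mul _), integral_const_mul,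
    integral_const_mul, integral_const_mul] at h
  apply mul_left_cancel₀ hb.ne'
  rw [mul_add, ← mul_assoc b (2 * (n + 1) / b), mul_div_cancel₀ _ hb.ne']
  linarith

theorem integral_pow_mul_exp_neg_mul_sub_sq {b : ℝ} (hb : 0 < b) (m : ℝ) {k y : ℂ}
    (hk : k ^ 2 = -1 / b) (hy : k * y = m) (n : ℕ) :
    ((∫ t : ℝ, (2 * t) ^ n * Real.exp (-b * (t - m) ^ 2) : ℝ) : ℂ) =
      (Real.sqrt (Real.pi / b) : ℝ) * (k ^ n * HphysC n y) := by
  have h0 : ∫ t : ℝ, Real.exp (-b * (t - m) ^ 2) = Real.sqrt (Real.pi / b) := by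
    rw [integral_sub_right_eq_self (fun t : ℝ => Real.exp (-b * t ^ 2)) m, integral_gaussian]
  induction n using Nat.twoStepInduction with
  | zero => simp only [pow_zero, one_mul, h0]; simp [HphysC]
  | one =>
    have hi := integrable_pow_mul_exp_neg_mul_sub_sq hb m
    have hd (t : ℝ) : HasDerivAt (fun t : ℝ => Real.exp (-b * (t - m) ^ 2))
        (2 * b * m * ((2 * t) ^ 0 * Real.exp (-b * (t - m) ^ 2)) -
          b * ((2 * t) ^ 1 * Real.exp (-b * (t - m) ^ 2))) t := by
      have h : HasDerivAt (fun t : ℝ => Real.exp (-b * (t - m) ^ 2)) _ t :=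
        ((((hasDerivAt_id t).sub_const m).pow 2).const_mul (-b)).exp
      refine h.congr_deriv ?_
      simp
      ring
    have h := integral_eq_zero_of_hasDerivAt_of_integrable hd
      (((hi 0).const_mul _).sub ((hi 1).const_mul b)) (by simpa using hi 0)
    rw [integral_sub ((hi 0).const_mul _) ((hi 1).const_mul b), integral_const_mul,
      integral_const_mul] at h
    simp only [pow_zero, one_mul, h0] at h
    have h' : ∫ t : ℝ, (2 * t) ^ 1 * Real.exp (-b * (t - m) ^ 2) =
        2 * m * Real.sqrt (Real.pi / b) := by
      apply mul_left_cancel₀ hb.ne'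
      linarith
    rw [h']
    simp [HphysC]
    rw [← hy]
    ring
  | more n ih0 ih1 =>
    rw [integral_pow_add_two_mul_exp_neg_mul_sub_sq hb, HphysC_add_two]
    push_cast at ih0 ih1 ⊢
    rw [ih0, ih1]
    linear_combination
      -2 * ((Real.sqrt (Real.pi / b) : ℝ) : ℂ) * k ^ (n + 1) * HphysC (n + 1) y * hy +
        2 * (n + 1) * ((Real.sqrt (Real.pi / b) : ℝ) : ℂ) * k ^ n * HphysC n y * hk

theorem gaussian_convolution_monomial (r s : ℝ) (hr : 0 < r) (hs : 0 < s)
    (n : ℕ) (x : ℝ) (c : ℂ) (hc : c ^ 2 = -(r : ℂ) * (s : ℂ) * ((r : ℂ) + (s : ℂ))) :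
    ((1 / Real.sqrt (Real.pi * s) : ℝ) : ℂ) *
      ∫ ξ : ℝ, ((Real.exp (-(x - ξ) ^ 2 / s) * Real.exp (-ξ ^ 2 / r) * (2 * ξ) ^ n : ℝ) : ℂ) =
    ((Real.sqrt (r / (r + s)) : ℝ) : ℂ) * ((Real.exp (-x ^ 2 / (r + s)) : ℝ) : ℂ) *
      (c / ((r : ℂ) + (s : ℂ))) ^ n * HphysC n ((r : ℂ) * (x : ℂ) / c) := by
  have hrs : 0 < r + s := add_pos hr hs
  have hr' : (r : ℂ) ≠ 0 := by exact_mod_cast hr.ne'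
  have hs' : (s : ℂ) ≠ 0 := by exact_mod_cast hs.ne'
  have hrs' : (r : ℂ) + s ≠ 0 := by exact_mod_cast hrs.ne'
  have hc0 : c ≠ 0 := by
    rintro rfl
    simp [hr', hs', hrs'] at hc
  have hb : 0 < (r + s) / (r * s) := by positivity
  have hint (ξ : ℝ) : Real.exp (-(x - ξ) ^ 2 / s) * Real.exp (-ξ ^ 2 / r) * (2 * ξ) ^ n =
      Real.exp (-x ^ 2 / (r + s)) * ((2 * ξ) ^ n *
        Real.exp (-((r + s) / (r * s)) * (ξ - r * x / (r + s)) ^ 2)) := by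
    rw [mul_left_comm, ← Real.exp_add, ← Real.exp_add, mul_comm]
    congr 2
    field_simp
    ring
  have hsqrt : 1 / Real.sqrt (Real.pi * s) * Real.sqrt (Real.pi / ((r + s) / (r * s))) =
      Real.sqrt (r / (r + s)) := by
    rw [one_div, ← Real.sqrt_inv, ← Real.sqrt_mul (by positivity)]
    congr 1
    field_simp
  simp only [hint]
  rw [integral_complex_ofReal, integral_const_mul, Complex.ofReal_mul,
    integral_pow_mul_exp_neg_mul_sub_sq hb (r * x / (r + s)) (k := c / (r + s))
      (y := r * x / c) (by rw [div_pow, hc]; push_cast; field_simp)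
      (by push_cast; field_simp), ← hsqrt, Complex.ofReal_mul]
  ring
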